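/- Let n > 0 with n ≠ 1/2, let δ = (2 − n)/(1 − 2n), and let λ > 0. Suppose f : ℝ → ℝ is twice differentiable and the associated function g(η) = |f''(η)|^(n−1) · f''(η) is differentiable with g'(η) = −(1/(n+1)) · f(η) · f''(η) for every η. Define f*(x) = λ · f(λ^(−δ) · x). Then f* is twice differentiable and the function g*(x) = |f*''(x)|^(n−1) · f*''(x) is differentiable with g*'(x) = −(1/(n+1)) · f*(x) · f*''(x) for every x; that is, the governing differential equation of the extended Blasius problem is invariant under the scaling group f* = λ f, η* = λ^δ η. -/

import Mathlib

/-- The first derivative of a dilated and rescaled function. -/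
theorem deriv_const_mul_comp_mul_left (a c : ℝ) (f : ℝ → ℝ) :
    deriv (fun x => a * f (c * x)) = fun x => (a * c) * deriv f (c * x) := by
  funext x
  rw [deriv_const_mul_field, deriv_comp_mul_left, smul_eq_mul, mul_assoc]

/-- The exponent identity that selects `δ = (2 − n)/(1 − 2n)`. -/
theorem blasius_scaling_exponent {n δ lam : ℝ} (hn2 : n ≠ 1 / 2)
    (hδ : δ = (2 - n) / (1 - 2 * n)) (hlam : 0 < lam) :
    (lam * lam ^ (-δ) * lam ^ (-δ)) ^ (n - 1) * lam ^ (-δ) = lam := by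
  have hne : 1 - 2 * n ≠ 0 := fun h => hn2 (by linarith)
  have hexp : (1 + -δ + -δ) * (n - 1) + -δ = 1 := by
    rw [hδ]
    field_simp
    ring
  have hpow : lam * lam ^ (-δ) * lam ^ (-δ) = lam ^ (1 + -δ + -δ) := by
    rw [Real.rpow_add hlam, Real.rpow_add hlam, Real.rpow_one]
  rw [hpow, ← Real.rpow_mul hlam.le, ← Real.rpow_add hlam, hexp, Real.rpow_one]

/-- Invariance of the governing equation of the extended Blasius problem,
`d/dη(|f''|^(n-1) f'') + (1/(n+1)) f f'' = 0`, under the scaling group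
`f* = λ f`, `η* = λ^δ η` (i.e. `f*(x) = λ f(λ^(−δ) x)`), with
`δ = (2 − n)/(1 − 2n)`. -/
theorem extended_blasius_scaling_invariance
    (n δ lam : ℝ) (hn : 0 < n) (hn2 : n ≠ 1 / 2)
    (hδ : δ = (2 - n) / (1 - 2 * n)) (hlam : 0 < lam)
    (f : ℝ → ℝ)
    (hf : Differentiable ℝ f) (hf' : Differentiable ℝ (deriv f))
    (hg : Differentiable ℝ
      (fun η => |deriv (deriv f) η| ^ (n - 1) * deriv (deriv f) η))
    (hode : ∀ η, deriv
        (fun η => |deriv (deriv f) η| ^ (n - 1) * deriv (deriv f) η) η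
      = -(1 / (n + 1)) * f η * deriv (deriv f) η) :
    Differentiable ℝ (fun x => lam * f (lam ^ (-δ) * x)) ∧
    Differentiable ℝ (deriv (fun x => lam * f (lam ^ (-δ) * x))) ∧
    Differentiable ℝ
      (fun x => |deriv (deriv (fun x => lam * f (lam ^ (-δ) * x))) x| ^ (n - 1) *
        deriv (deriv (fun x => lam * f (lam ^ (-δ) * x))) x) ∧
    ∀ x, deriv
        (fun x => |deriv (deriv (fun x => lam * f (lam ^ (-δ) * x))) x| ^ (n - 1) *
          deriv (deriv (fun x => lam * f (lam ^ (-δ) * x))) x) x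
      = -(1 / (n + 1)) * (lam * f (lam ^ (-δ) * x)) *
          deriv (deriv (fun x => lam * f (lam ^ (-δ) * x))) x := by
  have hexp := blasius_scaling_exponent hn2 hδ hlam
  have hc : 0 < lam ^ (-δ) := Real.rpow_pos_of_pos hlam _
  generalize lam ^ (-δ) = c at hexp hc ⊢
  have hdil : Differentiable ℝ (fun x : ℝ => c * x) := by fun_prop
  have hK : 0 < lam * c * c := by positivity
  have hstar : (fun x => |lam * c * c * deriv (deriv f) (c * x)| ^ (n - 1) *
        (lam * c * c * deriv (deriv f) (c * x))) =
      fun x => ((lam * c * c) ^ (n - 1) * (lam * c * c)) *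
        (fun η => |deriv (deriv f) η| ^ (n - 1) * deriv (deriv f) η) (c * x) := by
    funext x
    rw [abs_mul, abs_of_pos hK, Real.mul_rpow hK.le (abs_nonneg _)]
    ring
  simp only [deriv_const_mul_comp_mul_left]
  refine ⟨(hf.comp hdil).const_mul _, (hf'.comp hdil).const_mul _, ?_, fun x => ?_⟩
  · rw [hstar]
    exact (hg.comp hdil).const_mul _
  · rw [hstar, deriv_const_mul_comp_mul_left _ _
      (fun η => |deriv (deriv f) η| ^ (n - 1) * deriv (deriv f) η)]
    simp only [hode]
    linear_combination
      (lam * c * c * (-(1 / (n + 1)) * f (c * x) * deriv (deriv f) (c * x))) * hexp
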